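/- Let f_0^t denote the time-t flow of the Sergeraert vector field ξ_0, and set a_l = f_0^l(1) for l ∈ ℤ. Then for every n ≥ 4 there exist integers i(n) and j(n) such that: 2^{−n} − 2^{−n−1}/6 ≤ a_{i(n)+2} < a_{i(n)−1} ≤ 2^{−n} + 2^{−n}/6, and 2^{−n−1} + 2^{−n−1}/3 ≤ a_{j(n)+2} < a_{j(n)−1} ≤ 2^{−n} − 2^{−n−1}/3. Consequently, for every t ∈ [0,1], f_0^t(x) = x − t·v_n for all x ∈ [a_{j(n)+1}, a_{j(n)−1}], and f_0^t coincides with the translation x ↦ x − t·u_n on a neighbourhood of a_{i(n)}. -/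

import Mathlib

open Set Filter Topology

/-- `f` is a diffeomorphism of the half-line `[0,∞)`: it fixes `0`, maps `[0,∞)` bijectively
onto itself, is differentiable (in the sense of `[0,∞)`) with everywhere positive derivative,
and its inverse is differentiable. -/
def HalfLineDiffeo (f : ℝ → ℝ) : Prop :=
  f 0 = 0 ∧ Set.BijOn f (Set.Ici 0) (Set.Ici 0) ∧
    (∀ x ∈ Set.Ici (0 : ℝ), ∃ d : ℝ, 0 < d ∧ HasDerivWithinAt f d (Set.Ici 0) x) ∧
    (∀ y ∈ Set.Ici (0 : ℝ), ∃ d : ℝ,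
      HasDerivWithinAt (Function.invFunOn f (Set.Ici 0)) d (Set.Ici 0) y)

/-- `f` is a `C^r` diffeomorphism of `[0,∞)`. -/
def CrHalfLineDiffeo (r : ℕ∞) (f : ℝ → ℝ) : Prop :=
  HalfLineDiffeo f ∧ ContDiffOn ℝ r f (Set.Ici 0)

/-- The `C^r` centralizer of `f` : all `C^r` diffeomorphisms of `[0,∞)` commuting with `f`. -/
def Centralizer (r : ℕ∞) (f : ℝ → ℝ) : Set (ℝ → ℝ) :=
  {g | CrHalfLineDiffeo r g ∧ ∀ x ∈ Set.Ici (0 : ℝ), g (f x) = f (g x)}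

/-- `F` is the (complete, globally defined) flow of the vector field `ξ` on `[0,∞)`:
`F 0 x = x` and `∂ₜ F t x = ξ (F t x)` for all `t ∈ ℝ` and `x ∈ [0,∞)`. -/
def IsFlowOf (ξ : ℝ → ℝ) (F : ℝ → ℝ → ℝ) : Prop :=
  ∀ x ∈ Set.Ici (0 : ℝ), F 0 x = x ∧
    ∀ t : ℝ, F t x ∈ Set.Ici (0 : ℝ) ∧ HasDerivAt (fun s => F s x) (ξ (F t x)) t

noncomputable def uSeq (n : ℕ) : ℝ := (2 : ℝ) ^ (-((n : ℤ) ^ 4))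
noncomputable def vSeq (n : ℕ) : ℝ := (2 : ℝ) ^ (-((n : ℤ) ^ 2))
noncomputable def wSeq (n : ℕ) : ℝ := (2 : ℝ) ^ (-((n : ℤ) ^ 3))

/-- The pair of auxiliary plateau functions `α, β` used to define the Sergeraert field. -/
def IsBumpPair (α β : ℝ → ℝ) : Prop :=
  ContDiff ℝ ((⊤ : ℕ∞) : WithTop ℕ∞) α ∧ ContDiff ℝ ((⊤ : ℕ∞) : WithTop ℕ∞) β ∧
  (∀ t : ℝ, α t ∈ Set.Icc (0 : ℝ) 1) ∧ (∀ t : ℝ, β t ∈ Set.Icc (0 : ℝ) 1) ∧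
  (∀ t : ℝ, t ≤ 1 / 6 → α t = 0) ∧ (∀ t : ℝ, 1 / 3 ≤ t → α t = 1) ∧
  (∀ t : ℝ, t ≤ 1 / 6 → β t = 0) ∧ (∀ t : ℝ, 5 / 6 ≤ t → β t = 0) ∧
  (∀ t ∈ Set.Icc (1 / 3 : ℝ) (2 / 3), β t = 1)

/-- The defining equations of the Sergeraert vector field `ξ₀` built from `α` and `β`. -/
def IsSergeraertField (α β ξ₀ : ℝ → ℝ) : Prop :=
  ξ₀ 0 = 0 ∧ (∀ x : ℝ, 1 ≤ x → ξ₀ x = -1) ∧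
  ∀ n : ℕ, ∀ x ∈ Set.Icc ((2 : ℝ) ^ (-(n : ℤ) - 1)) ((2 : ℝ) ^ (-(n : ℤ))),
    ξ₀ x = -uSeq (n + 1) - (uSeq n - uSeq (n + 1)) * α ((2 : ℝ) ^ (n + 1) * x - 1)
      - (vSeq n - uSeq n) * β ((2 : ℝ) ^ (n + 1) * x - 1)

theorem uSeq_pos (n : ℕ) : 0 < uSeq n := by
  unfold uSeq; positivity

theorem uSeq_succ_le (n : ℕ) : uSeq (n + 1) ≤ uSeq n := by
  unfold uSeq
  refine zpow_le_zpow_right₀ one_le_two (neg_le_neg ?_)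
  push_cast
  gcongr
  linarith

theorem vSeq_pos (n : ℕ) : 0 < vSeq n := by
  unfold vSeq; positivity

theorem uSeq_le_vSeq (n : ℕ) : uSeq n ≤ vSeq n := by
  unfold uSeq vSeq
  refine zpow_le_zpow_right₀ one_le_two (neg_le_neg ?_)
  rcases Nat.eq_zero_or_pos n with rfl | hn
  · simp
  · exact pow_le_pow_right₀ (by exact_mod_cast hn) (by norm_num)

theorem mul_vSeq_le {n : ℕ} (hn : 4 ≤ n) : 64 * vSeq n ≤ (2 : ℝ) ^ (-(n : ℤ)) := by
  have h : (64 : ℝ) = (2 : ℝ) ^ (6 : ℤ) := by norm_num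
  unfold vSeq
  rw [h, ← zpow_add₀ two_ne_zero]
  refine zpow_le_zpow_right₀ one_le_two ?_
  have : (4 : ℤ) ≤ n := by exact_mod_cast hn
  nlinarith

theorem IsSergeraertField.le_neg_uSeq {α β ξ₀ : ℝ → ℝ} (hαβ : IsBumpPair α β)
    (hξ₀ : IsSergeraertField α β ξ₀) (N : ℕ) {x : ℝ} (hx : (2 : ℝ) ^ (-(N : ℤ)) ≤ x) :
    ξ₀ x ≤ -uSeq N := by
  induction N with
  | zero =>
    have h1 : (1 : ℝ) ≤ x := by simpa using hx
    simp [hξ₀.2.1 x h1, uSeq]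
  | succ N ih =>
    have hu := uSeq_succ_le N
    rcases le_total ((2 : ℝ) ^ (-(N : ℤ))) x with h | h
    · linarith [ih h]
    · have hx' : (2 : ℝ) ^ (-(N : ℤ) - 1) ≤ x := by
        convert hx using 2
        push_cast
        ring
      rw [hξ₀.2.2 N x ⟨hx', h⟩]
      have hα := mul_nonneg (sub_nonneg.2 hu) (hαβ.2.2.1 ((2 : ℝ) ^ (N + 1) * x - 1)).1
      have hβ := mul_nonneg (sub_nonneg.2 (uSeq_le_vSeq N))
        (hαβ.2.2.2.1 ((2 : ℝ) ^ (N + 1) * x - 1)).1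
      linarith

theorem IsSergeraertField.nonpos {α β ξ₀ : ℝ → ℝ} (hαβ : IsBumpPair α β)
    (hξ₀ : IsSergeraertField α β ξ₀) {x : ℝ} (hx : 0 ≤ x) : ξ₀ x ≤ 0 := by
  rcases hx.eq_or_lt with rfl | hx
  · exact hξ₀.1.le
  · obtain ⟨N, hN⟩ := exists_pow_lt_of_lt_one hx (by norm_num : (1 / 2 : ℝ) < 1)
    have : (2 : ℝ) ^ (-(N : ℤ)) ≤ x := by
      simpa [zpow_neg] using hN.le
    linarith [hξ₀.le_neg_uSeq hαβ N this, uSeq_pos N]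

theorem two_pow_succ_mul_zpow (n : ℕ) : (2 : ℝ) ^ (n + 1) * (2 : ℝ) ^ (-(n : ℤ)) = 2 := by
  rw [zpow_neg, zpow_natCast, pow_succ]
  field_simp

theorem two_zpow_sub_one (k : ℤ) : (2 : ℝ) ^ (k - 1) = (2 : ℝ) ^ k / 2 := by
  rw [zpow_sub_one₀ two_ne_zero, div_eq_mul_inv]

/-- The field is constant equal to `-v_n` in the middle third of `[2^{-n-1}, 2^{-n}]`. -/
theorem IsSergeraertField.eq_neg_vSeq {α β ξ₀ : ℝ → ℝ} (hαβ : IsBumpPair α β)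
    (hξ₀ : IsSergeraertField α β ξ₀) (n : ℕ) {x : ℝ}
    (hx : x ∈ Icc ((2 : ℝ) ^ (-(n : ℤ)) * (2 / 3)) ((2 : ℝ) ^ (-(n : ℤ)) * (5 / 6))) :
    ξ₀ x = -vSeq n := by
  obtain ⟨-, -, -, -, -, hα1, -, -, hβ1⟩ := hαβ
  have hp : (0 : ℝ) < 2 ^ (-(n : ℤ)) := by positivity
  have hq : (0 : ℝ) < 2 ^ (n + 1) := by positivity
  have hpq := two_pow_succ_mul_zpow n
  have hl := mul_le_mul_of_nonneg_left hx.1 hq.le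
  have hr := mul_le_mul_of_nonneg_left hx.2 hq.le
  rw [← mul_assoc, hpq] at hl hr
  rw [hξ₀.2.2 n x (by rw [two_zpow_sub_one]; constructor <;> linarith [hx.1, hx.2]),
    hα1 _ (by linarith), hβ1 _ ⟨by linarith, by linarith⟩]
  ring

/-- The field is constant equal to `-u_n` near `2^{-n}`. -/
theorem IsSergeraertField.eq_neg_uSeq {α β ξ₀ : ℝ → ℝ} (hαβ : IsBumpPair α β)
    (hξ₀ : IsSergeraertField α β ξ₀) {n : ℕ} (hn : 1 ≤ n) {x : ℝ}
    (hx : x ∈ Icc ((2 : ℝ) ^ (-(n : ℤ)) * (11 / 12)) ((2 : ℝ) ^ (-(n : ℤ)) * (7 / 6))) :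
    ξ₀ x = -uSeq n := by
  obtain ⟨-, -, -, -, hα0, hα1, hβ0, hβ0', -⟩ := hαβ
  have hp : (0 : ℝ) < 2 ^ (-(n : ℤ)) := by positivity
  rcases le_total x ((2 : ℝ) ^ (-(n : ℤ))) with h | h
  · have hl := mul_le_mul_of_nonneg_left hx.1 (by positivity : (0 : ℝ) ≤ 2 ^ (n + 1))
    rw [← mul_assoc, two_pow_succ_mul_zpow] at hl
    rw [hξ₀.2.2 n x (by rw [two_zpow_sub_one]; constructor <;> linarith [hx.1]),
      hα1 _ (by linarith), hβ0' _ (by linarith)]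
    ring
  · obtain ⟨m, rfl⟩ := Nat.exists_eq_add_of_le' hn
    have hm : (2 : ℝ) ^ (-((m + 1 : ℕ) : ℤ)) = (2 : ℝ) ^ (-(m : ℤ)) / 2 := by
      rw [← two_zpow_sub_one]
      congr 1
      push_cast
      ring
    rw [hm] at hx h hp
    have hr := mul_le_mul_of_nonneg_left hx.2 (by positivity : (0 : ℝ) ≤ 2 ^ (m + 1))
    have hpq := two_pow_succ_mul_zpow m
    rw [hξ₀.2.2 m x (by rw [two_zpow_sub_one]; constructor <;> linarith [hx.2]),
      hα0 _ (by linarith), hβ0 _ (by linarith)]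
    ring

/-- An integral curve of a nonpositive field moves at constant speed as long as it stays in an
interval on which the field is constant. -/
theorem integralCurve_eq_sub_mul {ξ h : ℝ → ℝ} (hd : ∀ t, HasDerivAt h (ξ (h t)) t)
    (hanti : Antitone h) {A B c : ℝ} (hc : 0 < c) (hξ : ∀ x ∈ Icc A B, ξ x = -c)
    {s t : ℝ} (ht : 0 ≤ t) (hB : h s ≤ B) (hA : A ≤ h s - t * c) :
    h (s + t) = h s - t * c := by
  have hcont : Continuous h := continuous_iff_continuousAt.2 fun t => (hd t).continuousAt
  have key : ∀ r, 0 ≤ r → A ≤ h (s + r) → h (s + r) = h s - r * c := by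
    intro r hr hAr
    have hd0 : ∀ q ∈ Icc s (s + r), HasDerivAt (fun q => h q + q * c) 0 q := by
      intro q hq
      have hmem : h q ∈ Icc A B := ⟨hAr.trans (hanti hq.2), (hanti hq.1).trans hB⟩
      have := (hd q).fun_add (hasDerivAt_mul_const c)
      rwa [hξ _ hmem, neg_add_cancel] at this
    have := constant_of_has_deriv_right_zero
      (fun q hq => (hd0 q hq).continuousAt.continuousWithinAt)
      (fun q hq => (hd0 q (Ico_subset_Icc_self hq)).hasDerivWithinAt) (s + r)
      ⟨by linarith, le_rfl⟩
    linarith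
  refine key t ht ?_
  by_contra! hlt
  obtain ⟨q, hq, hqA⟩ := intermediate_value_Icc' (by linarith : s ≤ s + t)
    hcont.continuousOn ⟨hlt.le, hA.trans (by nlinarith)⟩
  have hk := key (q - s) (by linarith [hq.1]) (by simp [hqA])
  rw [add_sub_cancel, hqA] at hk
  have hqt : q = s + t := by
    refine le_antisymm hq.2 ?_
    by_contra! hlt'
    nlinarith
  rw [← hqt, hqA] at hlt
  exact lt_irrefl _ hlt

theorem IsFlowOf.antitone {ξ : ℝ → ℝ} {F : ℝ → ℝ → ℝ} (hF : IsFlowOf ξ F)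
    (hξ : ∀ x, 0 ≤ x → ξ x ≤ 0) {x : ℝ} (hx : 0 ≤ x) : Antitone fun t => F t x :=
  antitone_of_hasDerivAt_nonpos (fun t => ((hF x hx).2 t).2)
    fun t => hξ _ ((hF x hx).2 t).1

/-- A flow line on which the field is bounded away from zero above `B` reaches `B`. -/
theorem IsFlowOf.exists_eq {ξ : ℝ → ℝ} {F : ℝ → ℝ → ℝ} (hF : IsFlowOf ξ F)
    (hξ : ∀ x, 0 ≤ x → ξ x ≤ 0) {x B c : ℝ} (hB : 0 ≤ B) (hBx : B ≤ x) (hc : 0 < c)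
    (hξB : ∀ y, B ≤ y → ξ y ≤ -c) : ∃ t, F t x = B := by
  have hx : 0 ≤ x := hB.trans hBx
  have hd := fun t => ((hF x hx).2 t).2
  have hcont : Continuous fun t => F t x :=
    continuous_iff_continuousAt.2 fun t => (hd t).continuousAt
  have hT : 0 ≤ x / c := by positivity
  have hle : F (x / c) x ≤ B := by
    by_contra! hlt
    have := image_le_of_deriv_right_le_deriv_boundary (f := fun t => F t x)
      (f' := fun t => ξ (F t x)) (a := 0) (b := x / c) (B := fun t => x - t * c)
      (B' := fun _ => -c) hcont.continuousOn (fun t _ => (hd t).hasDerivWithinAt)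
      (by simp [(hF x hx).1]) (by fun_prop)
      (fun t _ => by
        simpa using (((hasDerivAt_id t).mul_const c).const_sub x).hasDerivWithinAt)
      (fun t ht => hξB _ (hlt.le.trans (hF.antitone hξ hx ht.2.le)))
      ⟨hT, le_rfl⟩
    simp only [div_mul_cancel₀ x hc.ne', sub_self] at this
    linarith
  obtain ⟨t, -, ht⟩ := intermediate_value_Icc' hT hcont.continuousOn
    ⟨hle, by simpa [(hF x hx).1] using hBx⟩
  exact ⟨t, ht⟩

/-- An orbit reaching the top of a plateau of width at least four time-one steps has four
consecutive integer-time points in it, around which the flow is a translation. -/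
theorem IsFlowOf.exists_int_plateau {ξ : ℝ → ℝ} {F : ℝ → ℝ → ℝ} (hF : IsFlowOf ξ F)
    (hξ : ∀ x, 0 ≤ x → ξ x ≤ 0) {x₀ : ℝ} (hx₀ : 0 ≤ x₀) {a : ℤ → ℝ}
    (ha : ∀ l : ℤ, a l = F (l : ℝ) x₀) {A B c : ℝ} (hc : 0 < c) (hA : 0 ≤ A)
    (hAB : 4 * c ≤ B - A) (hplateau : ∀ x ∈ Icc A B, ξ x = -c) (hB : ∃ t, F t x₀ = B) :
    ∃ i : ℤ, A ≤ a (i + 2) ∧ a (i - 1) ≤ B ∧ a (i + 2) < a (i - 1) ∧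
      a (i + 1) = a i - c ∧ a (i - 1) = a i + c ∧
      ∀ t ∈ Icc (0 : ℝ) 1, ∀ x ∈ Icc (a (i + 1)) (a (i - 1)), F t x = x - t * c := by
  obtain ⟨t₀, ht₀⟩ := hB
  have hcurve : ∀ x, 0 ≤ x → ∀ s t, 0 ≤ t → F s x ≤ B → A ≤ F s x - t * c →
      F (s + t) x = F s x - t * c := fun x hx s t ht hB hA =>
    integralCurve_eq_sub_mul (h := fun t => F t x) (fun t => ((hF x hx).2 t).2)
      (hF.antitone hξ hx) hc hplateau ht hB hA
  have hθ0 := Int.le_ceil t₀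
  have hθ1 := Int.ceil_lt_add_one t₀
  have horbit : ∀ k : ℤ, ⌈t₀⌉ ≤ k → k ≤ ⌈t₀⌉ + 3 → a k = B - (k - t₀) * c := by
    intro k hk hk'
    have h1 : (⌈t₀⌉ : ℝ) ≤ k := by exact_mod_cast hk
    have h2 : (k : ℝ) ≤ ⌈t₀⌉ + 3 := by exact_mod_cast hk'
    have := hcurve x₀ hx₀ t₀ (k - t₀) (by linarith) ht₀.le (by rw [ht₀]; nlinarith)
    rw [ha, ← ht₀, ← this]
    congr 1
    ring
  have h0 := horbit (⌈t₀⌉ + 1 - 1) (by lia) (by lia)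
  have h1 := horbit (⌈t₀⌉ + 1) (by lia) (by lia)
  have h2 := horbit (⌈t₀⌉ + 1 + 1) (by lia) (by lia)
  have h3 := horbit (⌈t₀⌉ + 1 + 2) (by lia) (by lia)
  push_cast at h0 h1 h2 h3
  refine ⟨⌈t₀⌉ + 1, by nlinarith, by nlinarith, by nlinarith, by linarith, by linarith,
    fun t ht x hx => ?_⟩
  have hAx : A + c ≤ x := by nlinarith [hx.1]
  have hxB : x ≤ B := by nlinarith [hx.2]
  have hx0 : 0 ≤ x := by linarith
  have := hcurve x hx0 0 t ht.1
  rw [(hF x hx0).1, zero_add] at this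
  exact this hxB (by nlinarith [ht.2])

/-- Travel-time computation along the orbit `a_l = f₀^l(1)` of the Sergeraert flow: for each
`n ≥ 4` there are integers `i(n)`, `j(n)` locating consecutive orbit points in the `-u_n`
and `-v_n` plateaux; consequently `f₀^t` is the translation by `-t·v_n` on
`[a_{j(n)+1}, a_{j(n)-1}]` and by `-t·u_n` near `a_{i(n)}`, for `0 ≤ t ≤ 1`. -/
theorem statement9 (α β ξ₀ : ℝ → ℝ) (hαβ : IsBumpPair α β)
    (hξ₀ : IsSergeraertField α β ξ₀)
    (F₀ : ℝ → ℝ → ℝ) (hF₀ : IsFlowOf ξ₀ F₀)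
    (a : ℤ → ℝ) (ha : ∀ l : ℤ, a l = F₀ (l : ℝ) 1) :
    ∀ n : ℕ, 4 ≤ n → ∃ i j : ℤ,
      ((2 : ℝ) ^ (-(n : ℤ)) - (2 : ℝ) ^ (-(n : ℤ) - 1) / 6 ≤ a (i + 2) ∧
        a (i + 2) < a (i - 1) ∧
        a (i - 1) ≤ (2 : ℝ) ^ (-(n : ℤ)) + (2 : ℝ) ^ (-(n : ℤ)) / 6) ∧
      ((2 : ℝ) ^ (-(n : ℤ) - 1) + (2 : ℝ) ^ (-(n : ℤ) - 1) / 3 ≤ a (j + 2) ∧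
        a (j + 2) < a (j - 1) ∧
        a (j - 1) ≤ (2 : ℝ) ^ (-(n : ℤ)) - (2 : ℝ) ^ (-(n : ℤ) - 1) / 3) ∧
      (∀ t ∈ Set.Icc (0 : ℝ) 1, ∀ x ∈ Set.Icc (a (j + 1)) (a (j - 1)),
        F₀ t x = x - t * vSeq n) ∧
      (∃ ε : ℝ, 0 < ε ∧ ∀ x : ℝ, |x - a i| < ε →
        ∀ t ∈ Set.Icc (0 : ℝ) 1, F₀ t x = x - t * uSeq n) := by
  intro n hn
  have hξ : ∀ x, 0 ≤ x → ξ₀ x ≤ 0 := fun x hx => hξ₀.nonpos hαβ hx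
  have hp : (0 : ℝ) < 2 ^ (-(n : ℤ)) := by positivity
  have hp1 : (2 : ℝ) ^ (-(n : ℤ)) ≤ 1 / 2 := by
    calc (2 : ℝ) ^ (-(n : ℤ)) ≤ (2 : ℝ) ^ (-1 : ℤ) :=
          zpow_le_zpow_right₀ one_le_two (by lia)
      _ = 1 / 2 := by norm_num
  have hv := mul_vSeq_le hn
  have huv := uSeq_le_vSeq n
  have hreach : ∀ B : ℝ, (2 : ℝ) ^ (-(n : ℤ)) / 2 ≤ B → B ≤ 1 → ∃ t, F₀ t 1 = B := by
    intro B hB hB1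
    refine hF₀.exists_eq hξ (by linarith) hB1 (uSeq_pos (n + 1)) fun y hy =>
      hξ₀.le_neg_uSeq hαβ (n + 1) ?_
    rw [Nat.cast_add_one, neg_add, ← sub_eq_add_neg, two_zpow_sub_one]
    linarith
  obtain ⟨i, hi1, hi2, hi3, hi4, hi5, hi⟩ := hF₀.exists_int_plateau hξ zero_le_one ha
    (uSeq_pos n) (by positivity) (by linarith)
    (fun x hx => hξ₀.eq_neg_uSeq hαβ (by lia) hx) (hreach _ (by linarith) (by linarith))
  obtain ⟨j, hj1, hj2, hj3, -, -, hj⟩ := hF₀.exists_int_plateau hξ zero_le_one ha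
    (vSeq_pos n) (by positivity) (by linarith)
    (fun x hx => hξ₀.eq_neg_vSeq hαβ n hx) (hreach _ (by linarith) (by linarith))
  rw [two_zpow_sub_one]
  refine ⟨i, j, ⟨by linarith, hi3, by linarith⟩, ⟨by linarith, hj3, by linarith⟩, hj,
    uSeq n, uSeq_pos n, fun x hx t ht => hi t ht x ?_⟩
  rw [abs_lt] at hx
  constructor <;> linarith
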